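/- Let g be a Lie algebra over a field K of characteristic zero and let X be a generating sequence of elements of g. Then for every s ≥ 0 and all v, w ∈ g one has Ê^X_s(⁅v,w⁆) = Σ_{m=0}^{s} ⁅ Ê^X_m(v), Ê^X_{s−m}(w) ⁆; that is, the Lie transform preserves commutators of vector fields. -/

import Mathlib

open Finset

variable {K : Type*} [Field K] [CharZero K]

/-- The operators `Ê^X_s` of the Lie transform, for a sequence `L` of
endomorphisms (`L j = ad(X_j)`; `L 0` is unused):
`Ê_0 = 1`, `Ê_s = (1/s) ∑_{j=1}^{s} j • (L j ∘ Ê_{s-j})`. -/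
noncomputable def Eseq {V : Type*} [AddCommGroup V] [Module K V]
    (L : ℕ → Module.End K V) : ℕ → Module.End K V
  | 0 => 1
  | s + 1 => ((s + 1 : K))⁻¹ • ∑ j ∈ Finset.range (s + 1),
      ((j + 1 : K)) • (L (j + 1) * Eseq L (s - j))
  termination_by s => s
  decreasing_by omega

theorem sum_antidiagonal_triple_assoc {M : Type*} [AddCommMonoid M] (f : ℕ → ℕ → ℕ → M) (n : ℕ) :
    ∑ p ∈ antidiagonal n, ∑ q ∈ antidiagonal p.2, f p.1 q.1 q.2 =
      ∑ p ∈ antidiagonal n, ∑ q ∈ antidiagonal p.1, f q.1 q.2 p.2 := by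
  rw [sum_sigma', sum_sigma']
  refine sum_nbij' (fun x => ⟨(x.1.1 + x.2.1, x.2.2), (x.1.1, x.2.1)⟩)
    (fun x => ⟨(x.2.1, x.2.2 + x.1.2), (x.2.2, x.1.2)⟩) ?_ ?_ ?_ ?_ (fun _ _ => rfl) <;>
  · rintro ⟨⟨a, b⟩, ⟨c, d⟩⟩ h
    simp only [mem_sigma, HasAntidiagonal.mem_antidiagonal] at h ⊢
    obtain ⟨rfl, rfl⟩ := h
    simp [add_assoc]

theorem sum_antidiagonal_triple_left_comm {M : Type*} [AddCommMonoid M]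
    (f : ℕ → ℕ → ℕ → M) (n : ℕ) :
    ∑ p ∈ antidiagonal n, ∑ q ∈ antidiagonal p.2, f p.1 q.1 q.2 =
      ∑ p ∈ antidiagonal n, ∑ q ∈ antidiagonal p.2, f q.1 p.1 q.2 := by
  rw [sum_antidiagonal_triple_assoc f, sum_antidiagonal_triple_assoc fun a b c => f b a c]
  exact sum_congr rfl fun p _ => (Nat.sum_antidiagonal_swap (n := p.1)
    (f := fun q => f q.1 q.2 p.2)).symm

theorem natCast_smul_Eseq_apply {V : Type*} [AddCommGroup V] [Module K V]
    (L : ℕ → Module.End K V) (s : ℕ) (v : V) :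
    (s : K) • Eseq L s v = ∑ p ∈ antidiagonal s, (p.1 : K) • L p.1 (Eseq L p.2 v) := by
  cases s with
  | zero => simp
  | succ s =>
    have hs : (s + 1 : K) ≠ 0 := by exact_mod_cast s.succ_ne_zero
    rw [Nat.sum_antidiagonal_succ, Eseq, Nat.cast_succ, LinearMap.smul_apply, smul_inv_smul₀ hs,
      Nat.sum_antidiagonal_eq_sum_range_succ_mk]
    simp [LinearMap.sum_apply]

/-- for a generating sequence `X` of elements of a Lie algebra `g`,
`Ê^X_s ⁅v,w⁆ = ∑_{m=0}^{s} ⁅Ê^X_m v, Ê^X_{s−m} w⁆` for all `s`, `v`, `w`: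
the Lie transform preserves commutators of vector fields. -/
theorem lieTransform_bracket {g : Type*} [LieRing g] [LieAlgebra K g]
    (X : ℕ → g) (s : ℕ) (v w : g) :
    Eseq (fun i => LieAlgebra.ad K g (X i)) s ⁅v, w⁆ =
      ∑ m ∈ Finset.range (s + 1),
        ⁅Eseq (fun i => LieAlgebra.ad K g (X i)) m v,
          Eseq (fun i => LieAlgebra.ad K g (X i)) (s - m) w⁆ := by
  rw [← Nat.sum_antidiagonal_eq_sum_range_succ
    (fun a b => ⁅Eseq (fun i => LieAlgebra.ad K g (X i)) a v,
      Eseq (fun i => LieAlgebra.ad K g (X i)) b w⁆)]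
  induction s using Nat.strong_induction_on with
  | _ s ih =>
  obtain rfl | hs := eq_or_ne s 0
  · simp [Eseq]
  set E := Eseq (fun i => LieAlgebra.ad K g (X i))
  have rec_E (n : ℕ) (u : g) :
      (n : K) • E n u = ∑ p ∈ antidiagonal n, (p.1 : K) • ⁅X p.1, E p.2 u⁆ := by
    simpa using natCast_smul_Eseq_apply (fun i => LieAlgebra.ad K g (X i)) n u
  have hsK : (s : K) ≠ 0 := Nat.cast_ne_zero.mpr hs
  apply smul_right_injective g hsK
  change (s : K) • E s ⁅v, w⁆ = (s : K) • ∑ p ∈ antidiagonal s, ⁅E p.1 v, E p.2 w⁆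
  calc (s : K) • E s ⁅v, w⁆
      = ∑ p ∈ antidiagonal s, (p.1 : K) • ⁅X p.1, E p.2 ⁅v, w⁆⁆ := rec_E s _
    _ = ∑ p ∈ antidiagonal s, ∑ q ∈ antidiagonal p.2,
          ((p.1 : K) • ⁅⁅X p.1, E q.1 v⁆, E q.2 w⁆ + (p.1 : K) • ⁅E q.1 v, ⁅X p.1, E q.2 w⁆⁆) := by
        refine sum_congr rfl fun p hp => ?_
        obtain h0 | h0 := eq_or_ne p.1 0
        · simp [h0]
        · rw [HasAntidiagonal.mem_antidiagonal] at hp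
          rw [ih p.2 (by omega), lie_sum, smul_sum]
          exact sum_congr rfl fun q _ => by rw [leibniz_lie, smul_add]
    _ = ∑ p ∈ antidiagonal s, (p.1 : K) • ⁅E p.1 v, E p.2 w⁆ +
          ∑ p ∈ antidiagonal s, (p.2 : K) • ⁅E p.1 v, E p.2 w⁆ := by
        simp only [sum_add_distrib]
        congr 1
        · rw [sum_antidiagonal_triple_assoc fun a b c => (a : K) • ⁅⁅X a, E b v⁆, E c w⁆]
          refine sum_congr rfl fun p _ => ?_
          rw [← smul_lie, rec_E, sum_lie]
          simp only [smul_lie]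
        · rw [sum_antidiagonal_triple_left_comm fun a b c => (a : K) • ⁅E b v, ⁅X a, E c w⁆⁆]
          refine sum_congr rfl fun p _ => ?_
          rw [← lie_smul, rec_E, lie_sum]
          simp only [lie_smul]
    _ = (s : K) • ∑ p ∈ antidiagonal s, ⁅E p.1 v, E p.2 w⁆ := by
        rw [← sum_add_distrib, smul_sum]
        refine sum_congr rfl fun p hp => ?_
        rw [← add_smul, ← Nat.cast_add, HasAntidiagonal.mem_antidiagonal.mp hp]
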